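/- Fix c > 0 and let p = c/n. If c < 1, then there exists a constant K = K(c) such that w.h.p. every connected component of G(n,p) has at most K·log n vertices. If c > 1, then there exists a constant δ = δ(c) > 0 such that w.h.p. G(n,p) has exactly one connected component with at least δ·n vertices. -/

import Mathlib

open MeasureTheory Filter Finset Matrix

noncomputable section

/-- Bernoulli measure on `Bool` with success probability `p` (clamped to `[0,1]`). -/
def bernoulliBool (p : ℝ) : Measure Bool :=
  ENNReal.ofReal (max 0 (min p 1)) • Measure.dirac true +
    ENNReal.ofReal (1 - max 0 (min p 1)) • Measure.dirac false

instance (p : ℝ) : IsFiniteMeasure (bernoulliBool p) := by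
  constructor
  simp only [bernoulliBool, Measure.add_apply, Measure.smul_apply, smul_eq_mul,
    measure_univ, mul_one]
  exact ENNReal.add_lt_top.mpr ⟨ENNReal.ofReal_lt_top, ENNReal.ofReal_lt_top⟩

/-- Index type for potential `d`-dimensional faces on vertex set `Fin n`:
the `(d+1)`-element subsets. -/
abbrev FaceIdx (n d : ℕ) : Type := {s : Finset (Fin n) // s.card = d + 1}

/-- The distribution of the random `d`-complex `Y_d(n,p)`: each potential `d`-face
gets an independent Bernoulli(`p`) coin. (For `d = 1` this is the Erdős–Rényi model
`G(n,p)`.) -/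
def YMeasure (n d : ℕ) (p : ℝ) : Measure (FaceIdx n d → Bool) :=
  Measure.pi fun _ => bernoulliBool p

/-- The random `d`-complex: all faces of dimension `≤ d - 1` (i.e. all subsets of
cardinality `≤ d`, including `∅`, so that degree-0 homology below is reduced
homology), together with the chosen `d`-faces. -/
def Ycomplex (n d : ℕ) (ω : FaceIdx n d → Bool) : Finset (Finset (Fin n)) :=
  Finset.univ.filter fun s => s.card ≤ d ∨ ∃ h : s.card = d + 1, ω ⟨s, h⟩ = true

/-- The Erdős–Rényi random graph associated to a configuration of edge coins. -/
def graphOf (n : ℕ) (ω : FaceIdx n 1 → Bool) : SimpleGraph (Fin n) where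
  Adj i j := i ≠ j ∧ ∃ e : FaceIdx n 1, ω e = true ∧ i ∈ e.1 ∧ j ∈ e.1
  symm := ⟨fun i j ⟨hne, e, he, hi, hj⟩ => ⟨hne.symm, e, he, hj, hi⟩⟩
  loopless := ⟨fun i ⟨hne, _⟩ => hne rfl⟩

instance (n : ℕ) (ω : FaceIdx n 1 → Bool) : DecidableRel (graphOf n ω).Adj :=
  fun i j =>
    inferInstanceAs (Decidable (i ≠ j ∧ ∃ e : FaceIdx n 1, ω e = true ∧ i ∈ e.1 ∧ j ∈ e.1))

/-- The clique complex of the graph determined by the edge coins `ω`: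
faces are vertex sets of complete subgraphs (including `∅` and singletons). -/
def cliqueComplex (n : ℕ) (ω : FaceIdx n 1 → Bool) : Finset (Finset (Fin n)) :=
  Finset.univ.filter fun s => ∀ i ∈ s, ∀ j ∈ s, i ≠ j → (graphOf n ω).Adj i j

/-- The group of simplicial `G`-chains of a complex `K`, in cardinality `c`
(i.e. dimension `c - 1`): functions on the faces of `K` of cardinality `c`. -/
abbrev Chains {V : Type} [Fintype V] [DecidableEq V]
    (K : Finset (Finset V)) (c : ℕ) (G : Type) : Type :=
  {s : Finset V // s ∈ K ∧ s.card = c} → G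

/-- The simplicial boundary map, from chains of cardinality `c+1` to chains of
cardinality `c`, with the usual alternating signs coming from the linear order
on the vertices. -/
def chainBoundary {V : Type} [Fintype V] [DecidableEq V] [LinearOrder V]
    (K : Finset (Finset V)) (c : ℕ) {G : Type} [AddCommGroup G]
    (f : Chains K (c + 1) G) : Chains K c G :=
  fun τ => ∑ v : V,
    if h : v ∉ τ.1 ∧ insert v τ.1 ∈ K then
      ((-1 : ℤ) ^ (τ.1.filter (fun u => u < v)).card) •
        f ⟨insert v τ.1, h.2, by rw [Finset.card_insert_of_notMem h.1, τ.2.2]⟩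
    else 0

/-- Vanishing of the simplicial homology of `K` with coefficients in `G` in
degree `i` (faces of cardinality `i+1`): every cycle is a boundary.
If `∅ ∈ K` this is reduced homology (the boundary map to cardinality-0 chains
is the augmentation); in degrees `i ≥ 1` reduced and unreduced homology agree. -/
def HomologyZero {V : Type} [Fintype V] [DecidableEq V] [LinearOrder V]
    (K : Finset (Finset V)) (i : ℕ) (G : Type) [AddCommGroup G] : Prop :=
  ∀ f : Chains K (i + 1) G, chainBoundary K i f = 0 →
    ∃ g : Chains K (i + 2) G, chainBoundary K (i + 1) g = f

/-- Vanishing of top-dimensional homology `H_d(K,G)`, i.e. the kernel of the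
`d`-th boundary map is zero. -/
def TopHomologyZero {V : Type} [Fintype V] [DecidableEq V] [LinearOrder V]
    (K : Finset (Finset V)) (d : ℕ) (G : Type) [AddCommGroup G] : Prop :=
  ∀ f : Chains K (d + 1) G, chainBoundary K d f = 0 → f = 0

/-- The boundary map on real coefficients, as a linear map. -/
def chainBoundaryLin {V : Type} [Fintype V] [DecidableEq V] [LinearOrder V]
    (K : Finset (Finset V)) (c : ℕ) : Chains K (c + 1) ℝ →ₗ[ℝ] Chains K c ℝ where
  toFun := chainBoundary K c
  map_add' f g := by
    funext τ
    simp only [chainBoundary, Pi.add_apply]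
    rw [← Finset.sum_add_distrib]
    refine Finset.sum_congr rfl fun v _ => ?_
    split
    · simp [smul_add]
    · simp
  map_smul' r f := by
    funext τ
    simp only [chainBoundary, Pi.smul_apply, RingHom.id_apply]
    rw [Finset.smul_sum]
    refine Finset.sum_congr rfl fun v _ => ?_
    split
    · exact smul_comm _ _ _
    · simp

/-- The `k`-th Betti number of `K`: the dimension of the `k`-th real simplicial
homology, i.e. of (kernel of `∂_k`) / (image of `∂_{k+1}`). -/
def bettiNumber {V : Type} [Fintype V] [DecidableEq V] [LinearOrder V]
    (K : Finset (Finset V)) (k : ℕ) : ℕ :=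
  Module.finrank ℝ
    (↥(LinearMap.ker (chainBoundaryLin K k)) ⧸
      (LinearMap.range (chainBoundaryLin K (k + 1))).comap
        (LinearMap.ker (chainBoundaryLin K k)).subtype)

/-- The link of a face `σ` in the complex `K`. -/
def linkSet {V : Type} [Fintype V] [DecidableEq V]
    (K : Finset (Finset V)) (σ : Finset V) : Finset (Finset V) :=
  Finset.univ.filter fun τ => τ ∩ σ = ∅ ∧ τ ∪ σ ∈ K

/-- The graph underlying the link of a face `σ`: its vertices are the vertices
of the link, joined when they span an edge of the link. -/
def linkGraph {V : Type} [Fintype V] [DecidableEq V]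
    (K : Finset (Finset V)) (σ : Finset V) :
    SimpleGraph {v : V // {v} ∈ linkSet K σ} where
  Adj a b := a ≠ b ∧ ({a.1, b.1} : Finset V) ∈ linkSet K σ
  symm := ⟨fun a b ⟨hab, h⟩ => ⟨hab.symm, by rwa [Finset.pair_comm]⟩⟩
  loopless := ⟨fun a ⟨hab, _⟩ => hab rfl⟩

instance {V : Type} [Fintype V] [DecidableEq V] (K : Finset (Finset V)) (σ : Finset V) :
    DecidableRel (linkGraph K σ).Adj :=
  fun a b => inferInstanceAs (Decidable (a ≠ b ∧ ({a.1, b.1} : Finset V) ∈ linkSet K σ))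

/-- The normalized Laplacian `I - D^{-1/2} A D^{-1/2}` of a finite graph. -/
def normalizedLaplacian {W : Type} [Fintype W] [DecidableEq W]
    (H : SimpleGraph W) [DecidableRel H.Adj] : Matrix W W ℝ :=
  Matrix.of fun a b =>
    (if a = b then (1 : ℝ) else 0) -
      (if H.Adj a b then 1 / Real.sqrt ((H.degree a : ℝ) * (H.degree b : ℝ)) else 0)

/-- An elementary `d`-collapse step: remove a free `(d-1)`-face `σ` together with
the unique `d`-face `τ` containing it. -/
def CollapseStep {V : Type} [DecidableEq V] (d : ℕ) (K K' : Finset (Finset V)) : Prop :=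
  ∃ σ τ : Finset V, σ ∈ K ∧ τ ∈ K ∧ τ.card = d + 1 ∧ σ ⊆ τ ∧ σ.card = d ∧
    (∀ ρ ∈ K, σ ⊆ ρ → ρ.card = d + 1 → ρ = τ) ∧ K' = K \ {σ, τ}

/-- `K` is `d`-collapsible if some finite sequence of elementary collapses reduces it
to a complex of dimension at most `d-1`. -/
def IsDCollapsible {V : Type} [DecidableEq V] (d : ℕ) (K : Finset (Finset V)) : Prop :=
  ∃ K' : Finset (Finset V),
    Relation.ReflTransGen (CollapseStep d) K K' ∧ ∀ s ∈ K', s.card ≤ d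

/-- The geometric realization of a complex on vertex set `Fin n`, inside `ℝ^n`:
the union over the faces of the convex hulls of the corresponding standard
basis vectors. -/
def geomReal (n : ℕ) (K : Finset (Finset (Fin n))) : Set (Fin n → ℝ) :=
  ⋃ σ ∈ K, convexHull ℝ ((fun i => (Pi.single i 1 : Fin n → ℝ)) '' ↑σ)

/-- The boundary of the simplex on the vertex set `τ`, as a chain of cardinality
`c` (to be used with `τ.card = c + 1`): the alternating sum of the `c`-element
subsets of `τ`. -/
def simplexBoundaryChain {V : Type} [Fintype V] [DecidableEq V] [LinearOrder V]
    (K : Finset (Finset V)) (c : ℕ) (τ : Finset V) : Chains K c ℝ :=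
  fun σ => ∑ v ∈ τ,
    if σ.1 = τ.erase v then ((-1 : ℝ) ^ (τ.filter (fun u => u < v)).card) else 0

/-- Index type for the multiparameter model: all potential faces of dimension `≥ 1`. -/
abbrev MultiIdx (n : ℕ) : Type := {s : Finset (Fin n) // 2 ≤ s.card}

/-- The distribution of the multiparameter random complex `X(n; p₁, p₂, …)`:
a potential face of cardinality `i+1` gets an independent Bernoulli(`p i`) coin. -/
def multiMeasure (n : ℕ) (p : ℕ → ℝ) : Measure (MultiIdx n → Bool) :=
  Measure.pi fun t => bernoulliBool (p (t.1.card - 1))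

/-- The multiparameter random complex: a set `s` is a face iff every subset of `s`
of dimension `≥ 1` has its coin turned on (this is exactly the
inductive-by-dimension construction: a face is present iff its coin is on and all
of its boundary faces are present). -/
def multiComplex (n : ℕ) (ω : MultiIdx n → Bool) : Finset (Finset (Fin n)) :=
  Finset.univ.filter fun s => ∀ t : MultiIdx n, t.1 ⊆ s → ω t = true

/-- The Vietoris–Rips complex of the points `pts` at scale `r`. -/
def VRcomplex (n d : ℕ) (pts : Fin n → EuclideanSpace ℝ (Fin d)) (r : ℝ) :
    Finset (Finset (Fin n)) :=
  Finset.univ.filter fun s => ∀ i ∈ s, ∀ j ∈ s, dist (pts i) (pts j) ≤ r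

end

noncomputable section

/-- The edge slot `{i,j}`. -/
def pr {n : ℕ} (i j : Fin n) (h : i ≠ j) : FaceIdx n 1 := ⟨{i, j}, by rw [Finset.card_pair h]⟩

lemma adj_iff {n : ℕ} (ω : FaceIdx n 1 → Bool) {i j : Fin n} (h : i ≠ j) :
    (graphOf n ω).Adj i j ↔ ω (pr i j h) = true := by
  constructor
  · rintro ⟨_, e, he, hi, hj⟩
    have : e = pr i j h := by
      apply Subtype.ext
      symm
      apply Finset.eq_of_subset_of_card_le
      · intro x hx
        simp only [pr, Finset.mem_insert, Finset.mem_singleton] at hx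
        rcases hx with rfl | rfl <;> assumption
      · rw [e.2, (pr i j h).2]
    rwa [← this]
  · intro he
    exact ⟨h, pr i j h, he, by simp [pr], by simp [pr]⟩

lemma cyl {E α : Type} [Fintype E] [DecidableEq E] [MeasurableSpace α] (ν : Measure α)
    [IsProbabilityMeasure ν] (F₁ F₂ : Finset E) (hd : Disjoint F₁ F₂) (A B : Set α) :
    (Measure.pi fun _ : E => ν).real {ω | (∀ e ∈ F₁, ω e ∈ A) ∧ ∀ e ∈ F₂, ω e ∈ B} =
      ν.real A ^ F₁.card * ν.real B ^ F₂.card := by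
  classical
  have hs : {ω : E → α | (∀ e ∈ F₁, ω e ∈ A) ∧ ∀ e ∈ F₂, ω e ∈ B} =
      Set.pi Set.univ (fun e => if e ∈ F₁ then A else if e ∈ F₂ then B else Set.univ) := by
    ext ω
    simp only [Set.mem_ofPred_eq, Set.mem_pi, Set.mem_univ, true_implies]
    constructor
    · rintro ⟨h1, h2⟩ e
      split_ifs with a b
      · exact h1 e a
      · exact h2 e b
      · trivial
    · intro h
      refine ⟨fun e he => ?_, fun e he => ?_⟩
      · simpa [he] using h e
      · have : e ∉ F₁ := fun h' => (Finset.disjoint_left.1 hd h' he)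
        simpa [he, this] using h e
  rw [hs, measureReal_def, Measure.pi_pi, ENNReal.toReal_prod]
  have : ∀ e : E, (ν (if e ∈ F₁ then A else if e ∈ F₂ then B else Set.univ)).toReal =
      (if e ∈ F₁ then ν.real A else 1) * (if e ∈ F₂ then ν.real B else 1) := by
    intro e
    by_cases h1 : e ∈ F₁
    · have : e ∉ F₂ := fun h' => (Finset.disjoint_left.1 hd h1 h')
      simp [h1, this, measureReal_def]
    · by_cases h2 : e ∈ F₂ <;> simp [h1, h2, measureReal_def]
  simp_rw [this]
  rw [Finset.prod_mul_distrib]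
  simp [Finset.prod_ite_mem]

/-- Master cylinder bound. -/
lemma cyl_graph {n : ℕ} {α ι κ : Type} [MeasurableSpace α] [Fintype ι] [Fintype κ]
    (ν : Measure α) [IsProbabilityMeasure ν] (φ ψ : α → Bool)
    (u w : ι → Fin n) (u' w' : κ → Fin n) (h : ∀ k, u k ≠ w k) (h' : ∀ k, u' k ≠ w' k)
    (hi : Function.Injective fun k => ({u k, w k} : Finset (Fin n)))
    (hi' : Function.Injective fun k => ({u' k, w' k} : Finset (Fin n)))
    (hd : ∀ k l, ({u k, w k} : Finset (Fin n)) ≠ {u' l, w' l}) :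
    (Measure.pi fun _ : FaceIdx n 1 => ν).real {ω |
      (∀ k, (graphOf n (φ ∘ ω)).Adj (u k) (w k)) ∧
      ∀ k, ¬ (graphOf n (ψ ∘ ω)).Adj (u' k) (w' k)} =
    ν.real {a | φ a = true} ^ Fintype.card ι * ν.real {a | ψ a = false} ^ Fintype.card κ := by
  classical
  let F₁ : Finset (FaceIdx n 1) := Finset.univ.image fun k => pr (u k) (w k) (h k)
  let F₂ : Finset (FaceIdx n 1) := Finset.univ.image fun k => pr (u' k) (w' k) (h' k)
  have c1 : F₁.card = Fintype.card ι := by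
    apply Finset.card_image_of_injective
    intro a b hab
    exact hi (congrArg Subtype.val hab)
  have c2 : F₂.card = Fintype.card κ := by
    apply Finset.card_image_of_injective
    intro a b hab
    exact hi' (congrArg Subtype.val hab)
  have hdis : Disjoint F₁ F₂ := by
    rw [Finset.disjoint_left]
    intro e h1 h2
    simp only [F₁, F₂, Finset.mem_image, Finset.mem_univ, true_and] at h1 h2
    obtain ⟨k, rfl⟩ := h1
    obtain ⟨l, hl⟩ := h2
    exact hd k l (congrArg Subtype.val hl).symm
  rw [← c1, ← c2, ← cyl ν F₁ F₂ hdis]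
  congr 1
  ext ω
  simp only [Set.mem_ofPred_eq, F₁, F₂, Finset.mem_image, Finset.mem_univ, true_and,
    forall_exists_index, forall_apply_eq_imp_iff]
  refine and_congr (forall_congr' fun k => ?_) (forall_congr' fun k => ?_)
  · rw [adj_iff _ (h k)]; rfl
  · rw [adj_iff _ (h' k)]; simp

/-- One growth step. -/
def GStep {V : Type} [DecidableEq V] (H : SimpleGraph V) (T T' : Finset V) : Prop :=
  ∃ x y, y ∈ T ∧ x ∉ T ∧ H.Adj x y ∧ T' = insert x T

/-- `S` can be grown from `R`. -/
def Grow {V : Type} [DecidableEq V] (H : SimpleGraph V) (R S : Finset V) : Prop :=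
  Relation.ReflTransGen (GStep H) R S

section grow
variable {V : Type} [DecidableEq V] {H H' : SimpleGraph V} {R S T Q : Finset V}

lemma Grow.subset (h : Grow H R S) : R ⊆ S := by
  induction h with
  | refl => exact Finset.Subset.refl _
  | tail _ h ih =>
    obtain ⟨x, y, hy, hx, ha, rfl⟩ := h
    exact ih.trans (Finset.subset_insert _ _)

lemma Grow.mono (hH : H ≤ H') (h : Grow H R S) : Grow H' R S :=
  Relation.ReflTransGen.mono (fun _ _ ⟨x, y, hy, hx, ha, e⟩ => ⟨x, y, hy, hx, hH ha, e⟩) _ _ h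

lemma Grow.union (h : Grow H R S) (Q : Finset V) : Grow H (R ∪ Q) (S ∪ Q) := by
  induction h with
  | refl => exact Relation.ReflTransGen.refl
  | @tail T T' _ h ih =>
    obtain ⟨x, y, hy, hx, ha, rfl⟩ := h
    by_cases hxQ : x ∈ Q
    · have : insert x T ∪ Q = T ∪ Q := by
        ext z; simp only [Finset.mem_union, Finset.mem_insert]
        constructor
        · rintro ((rfl | h) | h) <;> tauto
        · tauto
      rwa [this]
    · refine ih.tail ⟨x, y, by simp [hy], by simp [hx, hxQ], ha, ?_⟩
      simp [Finset.insert_union]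

lemma Grow.parent (h : Grow H R S) : ∃ f : V → V, (∀ x ∈ S \ R, f x ∈ S ∧ H.Adj x (f x)) ∧
    ∀ x ∈ S \ R, ∀ y ∈ S \ R, ({x, f x} : Finset V) = {y, f y} → x = y := by
  induction h with
  | refl => exact ⟨id, by simp, by simp⟩
  | @tail T T' hg h ih =>
    obtain ⟨x, y, hy, hx, ha, rfl⟩ := h
    obtain ⟨f, h1, h2⟩ := ih
    have hRT : R ⊆ T := Grow.subset hg
    have key : ∀ z ∈ T \ R, ({z, f z} : Finset V) ≠ {x, y} := by
      intro z hz e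
      have : x ∈ ({z, f z} : Finset V) := by rw [e]; simp
      simp only [Finset.mem_insert, Finset.mem_singleton] at this
      rcases this with rfl | h
      · exact hx (Finset.mem_sdiff.1 hz).1
      · exact hx (h ▸ (h1 z hz).1)
    have hne : ∀ z ∈ T \ R, z ≠ x := by
      rintro z hz rfl; exact hx (Finset.mem_sdiff.1 hz).1
    have split : ∀ z ∈ insert x T \ R, z = x ∨ z ∈ T \ R := by
      intro z hz
      simp only [Finset.mem_sdiff, Finset.mem_insert] at hz ⊢
      tauto
    refine ⟨Function.update f x y, ?_, ?_⟩
    · intro z hz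
      rcases split z hz with rfl | hz'
      · simp [hy, ha]
      · rw [Function.update_of_ne (hne z hz')]
        exact ⟨Finset.mem_insert_of_mem (h1 z hz').1, (h1 z hz').2⟩
    · intro z hz z' hz' e
      rcases split z hz with rfl | hzz <;> rcases split z' hz' with rfl | hzz'
      · rfl
      · rw [Function.update_self, Function.update_of_ne (hne z' hzz')] at e
        exact absurd e.symm (key z' hzz')
      · rw [Function.update_self, Function.update_of_ne (hne z hzz)] at e
        exact absurd e (key z hzz)
      · rw [Function.update_of_ne (hne z hzz), Function.update_of_ne (hne z' hzz')] at e
        exact h2 z hzz z' hzz' e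

/-- A set all of whose points are reachable from `R`, and which is closed, grows from `R`. -/
lemma grow_of_reach (hRS : R ⊆ S) (hcl : ∀ x ∈ S, ∀ y, H.Adj x y → y ∈ S)
    (hr : ∀ x ∈ S, ∃ r ∈ R, H.Reachable r x) : Grow H R S := by
  classical
  obtain ⟨T, hT, hmax⟩ := Finset.exists_max_image (S.powerset.filter (fun T => Grow H R T))
    Finset.card ⟨R, by simp [hRS]; exact Relation.ReflTransGen.refl⟩
  simp only [Finset.mem_filter, Finset.mem_powerset] at hT hmax
  by_cases hTS : T = S
  · exact hTS ▸ hT.2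
  obtain ⟨x, hxS, hxT⟩ := Finset.exists_of_ssubset (hT.1.ssubset_of_ne hTS)
  obtain ⟨r, hrR, ⟨p⟩⟩ := hr x hxS
  obtain ⟨d, hd, h1, h2⟩ := p.exists_boundary_dart (T : Set V) (hT.2.subset hrR) hxT
  simp only [Finset.mem_coe] at h1 h2
  have h3 := hmax (insert d.snd T) ⟨Finset.insert_subset (hcl _ (hT.1 h1) _ d.adj) hT.1,
    hT.2.tail ⟨d.snd, d.fst, h1, h2, d.adj.symm, rfl⟩⟩
  rw [Finset.card_insert_of_notMem h2] at h3
  omega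

end grow

lemma ev_bound {n : ℕ} {α : Type} [MeasurableSpace α]
    (ν : Measure α) [IsProbabilityMeasure ν] (φ ψ : α → Bool) (R S : Finset (Fin n))
    (hRS : R ⊆ S) :
    (Measure.pi fun _ : FaceIdx n 1 => ν).real {ω | Grow (graphOf n (φ ∘ ω)) R S ∧
      ∀ x ∈ S, ∀ y, y ∉ S → ¬ (graphOf n (ψ ∘ ω)).Adj x y} ≤
    ((S.card : ℝ) * ν.real {a | φ a = true}) ^ (S.card - R.card) *
      ν.real {a | ψ a = false} ^ (S.card * (n - S.card)) := by
  classical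
  set μ := (Measure.pi fun _ : FaceIdx n 1 => ν)
  let Good : (↥(S \ R) → ↥S) → Prop := fun f =>
    (∀ k : ↥(S \ R), (k : Fin n) ≠ f k) ∧
      Function.Injective fun k : ↥(S \ R) => ({(k : Fin n), (f k : Fin n)} : Finset (Fin n))
  let Cyl : (↥(S \ R) → ↥S) → Set (FaceIdx n 1 → α) := fun f =>
    {ω | (∀ k : ↥(S \ R), (graphOf n (φ ∘ ω)).Adj k (f k)) ∧
      ∀ k : ↥S × ↥(Sᶜ), ¬ (graphOf n (ψ ∘ ω)).Adj (k.1 : Fin n) (k.2 : Fin n)}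
  have hsub : {ω : FaceIdx n 1 → α | Grow (graphOf n (φ ∘ ω)) R S ∧
      ∀ x ∈ S, ∀ y, y ∉ S → ¬ (graphOf n (ψ ∘ ω)).Adj x y} ⊆
      ⋃ f ∈ Finset.univ.filter Good, Cyl f := by
    rintro ω ⟨hg, hiso⟩
    obtain ⟨f, h1, h2⟩ := hg.parent
    simp only [Set.mem_iUnion]
    refine ⟨fun k => ⟨f k, (h1 k k.2).1⟩, ?_, ?_, ?_⟩
    · simp only [Finset.mem_filter, Finset.mem_univ, true_and]
      refine ⟨fun k => (h1 k k.2).2.ne, fun a b hab => Subtype.ext (h2 a a.2 b b.2 hab)⟩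
    · exact fun k => (h1 k k.2).2
    · exact fun k => hiso _ k.1.2 _ (Finset.mem_compl.1 k.2.2)
  have hcard1 : Fintype.card ↥(S \ R) = S.card - R.card := by
    rw [Fintype.card_coe, Finset.card_sdiff_of_subset hRS]
  have hcard2 : Fintype.card (↥S × ↥(Sᶜ)) = S.card * (n - S.card) := by
    rw [Fintype.card_prod, Fintype.card_coe, Fintype.card_coe, Finset.card_compl, Fintype.card_fin]
  have hcyl : ∀ f ∈ Finset.univ.filter Good, μ.real (Cyl f) ≤
      ν.real {a | φ a = true} ^ (S.card - R.card) *
      ν.real {a | ψ a = false} ^ (S.card * (n - S.card)) := by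
    intro f hf
    simp only [Finset.mem_filter, Finset.mem_univ, true_and] at hf
    have hne : ∀ k : ↥S × ↥(Sᶜ), (k.1 : Fin n) ≠ (k.2 : Fin n) := fun k e =>
      Finset.mem_compl.1 k.2.2 (e ▸ k.1.2)
    have := cyl_graph ν φ ψ (fun k : ↥(S \ R) => (k : Fin n)) (fun k => (f k : Fin n))
      (fun k : ↥S × ↥(Sᶜ) => (k.1 : Fin n)) (fun k => (k.2 : Fin n)) hf.1 hne hf.2
      (by
        rintro ⟨a, b⟩ ⟨a', b'⟩ e
        simp only at e
        have hb := Finset.mem_compl.1 b.2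
        have hb' := Finset.mem_compl.1 b'.2
        have e1 : (a : Fin n) ∈ ({(a' : Fin n), (b' : Fin n)} : Finset (Fin n)) := by
          rw [← e]; simp
        have e2 : (b : Fin n) ∈ ({(a' : Fin n), (b' : Fin n)} : Finset (Fin n)) := by
          rw [← e]; simp
        simp only [Finset.mem_insert, Finset.mem_singleton] at e1 e2
        have f1 : (a : Fin n) = a' := by
          rcases e1 with h | h
          · exact h
          · exact absurd (h ▸ a.2) hb'
        have f2 : (b : Fin n) = b' := by
          rcases e2 with h | h
          · exact absurd (h ▸ a'.2) hb
          · exact h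
        exact Prod.ext (Subtype.ext f1) (Subtype.ext f2))
      (by
        intro k l e
        have hb := Finset.mem_compl.1 l.2.2
        have e2 : (l.2 : Fin n) ∈ ({(k : Fin n), (f k : Fin n)} : Finset (Fin n)) := by
          rw [e]; simp
        simp only [Finset.mem_insert, Finset.mem_singleton] at e2
        rcases e2 with h | h
        · exact hb (h ▸ (Finset.mem_sdiff.1 k.2).1)
        · exact hb (h ▸ (f k).2))
    rw [hcard1, hcard2] at this
    exact this.le
  calc μ.real _ ≤ μ.real (⋃ f ∈ Finset.univ.filter Good, Cyl f) := measureReal_mono hsub (measure_ne_top _ _)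
    _ ≤ ∑ f ∈ Finset.univ.filter Good, μ.real (Cyl f) := measureReal_biUnion_finset_le _ _
    _ ≤ (Finset.univ.filter Good).card • (ν.real {a | φ a = true} ^ (S.card - R.card) *
      ν.real {a | ψ a = false} ^ (S.card * (n - S.card))) := Finset.sum_le_card_nsmul _ _ _ hcyl
    _ ≤ (S.card : ℝ) ^ (S.card - R.card) * (ν.real {a | φ a = true} ^ (S.card - R.card) *
      ν.real {a | ψ a = false} ^ (S.card * (n - S.card))) := by
        rw [nsmul_eq_mul]
        gcongr
        have : (Finset.univ.filter Good).card ≤ S.card ^ (S.card - R.card) := by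
          refine (Finset.card_le_univ _).trans ?_
          rw [Fintype.card_fun, hcard1, Fintype.card_coe]
        exact_mod_cast this
    _ = _ := by rw [mul_pow]; ring

lemma first_moment {n : ℕ} {α : Type} [MeasurableSpace α]
    (ν : Measure α) [IsProbabilityMeasure ν] (φ ψ : α → Bool) (c c1 x0 : ℝ) (hn : 0 < n)
    (hc : 0 ≤ c) (hc1 : 0 ≤ c1)
    (ha : ν.real {a | φ a = true} ≤ c / n) (hb : ν.real {a | ψ a = false} ≤ Real.exp (-c1 / n))
    (R : Finset (Fin n)) (s : ℕ) (hs : (s : ℝ) ≤ x0 * n) :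
    (Measure.pi fun _ : FaceIdx n 1 => ν).real {ω | ∃ S : Finset (Fin n), S.card = s ∧
      Grow (graphOf n (φ ∘ ω)) R S ∧
      ∀ x ∈ S, ∀ y, y ∉ S → ¬ (graphOf n (ψ ∘ ω)).Adj x y} ≤
    c ^ (s - R.card) * Real.exp (s * (1 - c1 * (1 - x0))) := by
  classical
  set μ := (Measure.pi fun _ : FaceIdx n 1 => ν)
  set j := s - R.card with hj
  have hn' : (0 : ℝ) < n := by exact_mod_cast hn
  let Ev : Finset (Fin n) → Set (FaceIdx n 1 → α) := fun S => {ω | S.card = s ∧ R ⊆ S ∧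
      (Grow (graphOf n (φ ∘ ω)) R S ∧
      ∀ x ∈ S, ∀ y, y ∉ S → ¬ (graphOf n (ψ ∘ ω)).Adj x y)}
  have hsub : {ω : FaceIdx n 1 → α | ∃ S : Finset (Fin n), S.card = s ∧
      Grow (graphOf n (φ ∘ ω)) R S ∧
      ∀ x ∈ S, ∀ y, y ∉ S → ¬ (graphOf n (ψ ∘ ω)).Adj x y} ⊆
      ⋃ T ∈ Finset.powersetCard j (Finset.univ : Finset (Fin n)), Ev (R ∪ T) := by
    rintro ω ⟨S, h1, h2, h3⟩
    have hRS := h2.subset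
    simp only [Set.mem_iUnion]
    refine ⟨S \ R, ?_, ?_⟩
    · simp [Finset.mem_powersetCard, Finset.card_sdiff_of_subset hRS, h1, hj]
    · rw [Finset.union_sdiff_of_subset hRS]
      exact ⟨h1, hRS, h2, h3⟩
  have hEv : ∀ S, μ.real (Ev S) ≤ ((s : ℝ) * (c / n)) ^ j *
      Real.exp (-c1 * s * (1 - x0)) := by
    intro S
    by_cases hS : S.card = s ∧ R ⊆ S
    · obtain ⟨hS, hRS⟩ := hS
      have h1 := ev_bound ν φ ψ R S hRS
      refine (measureReal_mono (fun ω h => h.2.2)).trans (h1.trans ?_)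
      rw [hS]
      have h2 : ν.real {a | ψ a = false} ^ (s * (n - s)) ≤ Real.exp (-c1 * s * (1 - x0)) := by
        calc _ ≤ Real.exp (-c1 / n) ^ (s * (n - s)) := by gcongr
          _ = Real.exp ((s * (n - s) : ℕ) * (-c1 / n)) := by rw [Real.exp_nat_mul]
          _ ≤ _ := by
            apply Real.exp_le_exp.2
            have h3 : ((n - s : ℕ) : ℝ) ≥ n * (1 - x0) := by
              have : (n : ℝ) ≤ (n - s : ℕ) + s := by exact_mod_cast (by omega : n ≤ n - s + s)
              nlinarith
            have h4 : c1 * s * ((n - s : ℕ) : ℝ) / n ≥ c1 * s * (1 - x0) := by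
              rw [ge_iff_le, le_div_iff₀ hn']
              have := mul_le_mul_of_nonneg_left h3 (show 0 ≤ c1 * s by positivity)
              nlinarith
            have h5 : ((s * (n - s) : ℕ) : ℝ) * (-c1 / n) = -(c1 * s * ((n - s : ℕ) : ℝ) / n) := by
              push_cast; ring
            rw [h5]; linarith
      gcongr
    · have : Ev S = ∅ := by
        ext ω
        simp only [Ev, Set.mem_ofPred_eq, Set.mem_empty_iff_false, iff_false]
        exact fun h => hS ⟨h.1, h.2.1⟩
      rw [this, measureReal_empty]
      positivity
  calc μ.real _ ≤ _ := measureReal_mono hsub (measure_ne_top _ _)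
    _ ≤ ∑ T ∈ Finset.powersetCard j (Finset.univ : Finset (Fin n)), μ.real (Ev (R ∪ T)) :=
      measureReal_biUnion_finset_le _ _
    _ ≤ (Finset.powersetCard j (Finset.univ : Finset (Fin n))).card • (((s : ℝ) * (c / n)) ^ j *
      Real.exp (-c1 * s * (1 - x0))) := Finset.sum_le_card_nsmul _ _ _ (fun T _ => hEv _)
    _ = (n.choose j : ℝ) * (((s : ℝ) * (c / n)) ^ j * Real.exp (-c1 * s * (1 - x0))) := by
      rw [nsmul_eq_mul]; simp
    _ ≤ ((n : ℝ) ^ j / (j.factorial : ℝ)) * (((s : ℝ) * (c / n)) ^ j *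
      Real.exp (-c1 * s * (1 - x0))) := by
        gcongr
        exact Nat.choose_le_pow_div j n
    _ = c ^ j * ((s : ℝ) ^ j / (j.factorial : ℝ)) * Real.exp (-c1 * s * (1 - x0)) := by
        rw [mul_pow, div_pow]; field_simp
    _ ≤ c ^ j * Real.exp s * Real.exp (-c1 * s * (1 - x0)) := by
        gcongr
        exact Real.pow_div_factorial_le_exp _ (by positivity) _
    _ = _ := by rw [mul_assoc, ← Real.exp_add]; ring_nf

/-- The vertex set of the component of `v`, as a finset. -/
def cf {n : ℕ} (H : SimpleGraph (Fin n)) (v : Fin n) : Finset (Fin n) :=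
  open Classical in Finset.univ.filter fun w => H.Reachable v w

lemma mem_cf {n : ℕ} {H : SimpleGraph (Fin n)} {v w : Fin n} : w ∈ cf H v ↔ H.Reachable v w := by
  simp [cf]

lemma ncard_supp {n : ℕ} (H : SimpleGraph (Fin n)) (v : Fin n) :
    (H.connectedComponentMk v).supp.ncard = (cf H v).card := by
  rw [← Set.ncard_coe_finset]
  congr 1
  ext w
  simp only [SimpleGraph.ConnectedComponent.mem_supp_iff, SimpleGraph.ConnectedComponent.eq,
    Finset.mem_coe, mem_cf]
  exact ⟨fun h => h.symm, fun h => h.symm⟩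

lemma cf_grow {n : ℕ} (H : SimpleGraph (Fin n)) (v : Fin n) : Grow H {v} (cf H v) := by
  apply grow_of_reach
  · simp [mem_cf]
  · intro x hx y hxy
    rw [mem_cf] at *
    exact hx.trans hxy.reachable
  · intro x hx
    exact ⟨v, by simp, mem_cf.1 hx⟩

lemma cf_iso {n : ℕ} (H : SimpleGraph (Fin n)) (v : Fin n) :
    ∀ x ∈ cf H v, ∀ y, y ∉ cf H v → ¬ H.Adj x y := by
  intro x hx y hy h
  rw [mem_cf] at *
  exact hy (hx.trans h.reachable)

/-- Path event. -/
def PathEv {n : ℕ} (l : ℕ) (x : Fin (l + 1) → Fin n) : Set (FaceIdx n 1 → Bool) :=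
  {ω | Function.Injective x ∧ ∀ i : Fin l, (graphOf n ω).Adj (x i.castSucc) (x i.succ)}

lemma pathEv_bound {n : ℕ} (ν : Measure Bool) [IsProbabilityMeasure ν] (l : ℕ)
    (x : Fin (l + 1) → Fin n) : (Measure.pi fun _ : FaceIdx n 1 => ν).real (PathEv l x) ≤
      ν.real {a | a = true} ^ l := by
  by_cases hx : Function.Injective x
  · have := cyl_graph (n := n) ν id id (fun i : Fin l => x i.castSucc) (fun i : Fin l => x i.succ)
      (Empty.elim) (Empty.elim) (fun k => by
        intro e
        have := hx e
        simp [Fin.ext_iff] at this) (fun k => k.elim)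
      (by
        intro i j e
        simp only at e
        have e1 : x i.castSucc ∈ ({x j.castSucc, x j.succ} : Finset (Fin n)) := by rw [← e]; simp
        have e2 : x i.succ ∈ ({x j.castSucc, x j.succ} : Finset (Fin n)) := by rw [← e]; simp
        simp only [Finset.mem_insert, Finset.mem_singleton, hx.eq_iff, Fin.ext_iff,
          Fin.val_castSucc, Fin.val_succ] at e1 e2
        apply Fin.ext
        omega) (fun k => k.elim) (fun _ k => k.elim)
    simp only [Fintype.card_fin, Fintype.card_empty, pow_zero, mul_one] at this
    refine le_trans (measureReal_mono ?_ (measure_ne_top _ _)) this.le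
    rintro ω ⟨_, h⟩
    exact ⟨h, fun k => k.elim⟩
  · have : PathEv l x = (∅ : Set (FaceIdx n 1 → Bool)) := by
      ext ω; simp [PathEv, hx]
    rw [this, measureReal_empty]
    positivity

lemma reach_path {n : ℕ} (ω : FaceIdx n 1 → Bool) {u w : Fin n}
    (h : (graphOf n ω).Reachable u w) :
    ∃ q : (Σ l : Fin n, (Fin ((l : ℕ) + 1) → Fin n)),
      ω ∈ PathEv q.1 q.2 ∧ q.2 0 = u ∧ q.2 (Fin.last _) = w := by
  classical
  obtain ⟨p⟩ := h
  have hp := p.toPath.2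
  set p' := p.toPath.1
  have hl : p'.length < n := by
    have := hp.length_lt
    simpa using this
  refine ⟨⟨⟨p'.length, hl⟩, fun i => p'.getVert i⟩, ⟨?_, ?_⟩, ?_, ?_⟩
  · intro i j e
    have := hp.getVert_injOn (by simp; omega) (by simp; omega) e
    exact Fin.ext this
  · intro i
    exact p'.adj_getVert_succ i.2
  · simp
  · simp

lemma big_comp_bound {n : ℕ} (hn : 0 < n) (ν : Measure Bool) [IsProbabilityMeasure ν] (c : ℝ)
    (hc0 : 0 ≤ c) (hc : c < 1) (ha : ν.real {a | a = true} ≤ c / n) (m : ℝ) (hm : 0 < m) :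
    (Measure.pi fun _ : FaceIdx n 1 => ν).real {ω | ∃ v, m ≤ (cf (graphOf n ω) v).card} ≤
      n / ((1 - c) * m ^ 2) := by
  classical
  set μ := (Measure.pi fun _ : FaceIdx n 1 => ν)
  have hn' : (0 : ℝ) < n := by exact_mod_cast hn
  let N : (FaceIdx n 1 → Bool) → ℝ := fun ω =>
    ∑ q : (Σ l : Fin n, (Fin ((l : ℕ) + 1) → Fin n)), (PathEv q.1 q.2).indicator (fun _ => (1 : ℝ)) ω
  have hms : ∀ s : Set (FaceIdx n 1 → Bool), MeasurableSet s := fun s => s.toFinite.measurableSet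
  have hint : ∀ q : (Σ l : Fin n, (Fin ((l : ℕ) + 1) → Fin n)),
      Integrable ((PathEv q.1 q.2).indicator (fun _ : FaceIdx n 1 → Bool => (1 : ℝ))) μ :=
    fun q => (integrable_const 1).indicator (hms _)
  have hEN : ∫ ω, N ω ∂μ ≤ n / (1 - c) := by
    simp only [N]
    rw [integral_finsetSum _ (fun q _ => hint q)]
    calc ∑ q : (Σ l : Fin n, (Fin ((l : ℕ) + 1) → Fin n)),
        ∫ ω, (PathEv q.1 q.2).indicator (fun _ => (1 : ℝ)) ω ∂μ
        ≤ ∑ q : (Σ l : Fin n, (Fin ((l : ℕ) + 1) → Fin n)), (c / n) ^ (q.1 : ℕ) := by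
          apply Finset.sum_le_sum
          intro q _
          rw [integral_indicator_const _ (hms _)]
          simp only [smul_eq_mul, mul_one]
          refine (pathEv_bound ν _ _).trans ?_
          gcongr
      _ = ∑ l : Fin n, n * c ^ (l : ℕ) := by
          rw [Fintype.sum_sigma]
          apply Finset.sum_congr rfl
          intro l _
          simp
          rw [div_pow, pow_succ]
          field_simp
      _ = n * ∑ l ∈ Finset.range n, c ^ l := by
          rw [← Finset.mul_sum, Fin.sum_univ_eq_sum_range (fun l => c ^ l)]
      _ ≤ n * (1 / (1 - c)) := by
          gcongr
          rw [le_div_iff₀ (by linarith), mul_comm]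
          have := mul_neg_geom_sum c n
          rw [this]
          have : 0 ≤ c ^ n := by positivity
          linarith
      _ = _ := by ring
  have hN0 : 0 ≤ᵐ[μ] N := ae_of_all _ fun ω => Finset.sum_nonneg fun q _ =>
    Set.indicator_nonneg (fun _ _ => zero_le_one) _
  have hNint : Integrable N μ := integrable_finsetSum _ (fun q _ => hint q)
  have hmk := mul_meas_ge_le_integral_of_nonneg hN0 hNint (m ^ 2)
  have hsub : {ω : FaceIdx n 1 → Bool | ∃ v, m ≤ (cf (graphOf n ω) v).card} ⊆
      {ω | m ^ 2 ≤ N ω} := by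
    rintro ω ⟨v, hv⟩
    simp only [Set.mem_ofPred_eq]
    let P := (Finset.univ : Finset (Σ l : Fin n, (Fin ((l : ℕ) + 1) → Fin n))).filter
      (fun q => ω ∈ PathEv q.1 q.2)
    have h1 : N ω = P.card := by
      simp only [N, P, Set.indicator_apply]
      rw [Finset.sum_boole]
    have h2 : (cf (graphOf n ω) v) ×ˢ (cf (graphOf n ω) v) ⊆
        P.image (fun q => (q.2 0, q.2 (Fin.last _))) := by
      rintro ⟨u, w⟩ h
      simp only [Finset.mem_product, mem_cf] at h
      obtain ⟨q, hq, h3, h4⟩ := reach_path ω (h.1.symm.trans h.2)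
      simp only [Finset.mem_image, P, Finset.mem_filter, Finset.mem_univ, true_and]
      exact ⟨q, hq, by rw [h3, h4]⟩
    have h3 := (Finset.card_le_card h2).trans Finset.card_image_le
    rw [Finset.card_product] at h3
    rw [h1]
    have h4 : ((cf (graphOf n ω) v).card : ℝ) * (cf (graphOf n ω) v).card ≤ P.card := by
      exact_mod_cast h3
    nlinarith
  have h5 := measureReal_mono hsub (measure_ne_top μ _)
  rw [le_div_iff₀ (by have : 0 < 1 - c := by linarith
                      positivity)]
  have h6 : m ^ 2 * μ.real {ω | m ^ 2 ≤ N ω} ≤ n / (1 - c) := hmk.trans hEN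
  rw [le_div_iff₀ (by linarith)] at h6
  have h7 : 0 < (1 - c) * m ^ 2 := by
    have : 0 < 1 - c := by linarith
    positivity
  have := mul_le_mul_of_nonneg_right h5 h7.le
  nlinarith

lemma tail_bound {n : ℕ} {α : Type} [MeasurableSpace α]
    (ν : Measure α) [IsProbabilityMeasure ν] (φ ψ : α → Bool) (c c1 x0 γ L D : ℝ) (hn : 0 < n)
    (hc : 0 < c) (hc1 : 0 ≤ c1) (hγ : 0 ≤ γ) (hg : Real.log c + 1 - c1 * (1 - x0) ≤ -γ)
    (ha : ν.real {a | φ a = true} ≤ c / n) (hb : ν.real {a | ψ a = false} ≤ Real.exp (-c1 / n))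
    (R : Finset (Fin n)) (hD0 : 0 ≤ D) (hD : ∀ s : ℕ, c ^ (s - R.card) ≤ D * c ^ s) :
    (Measure.pi fun _ : FaceIdx n 1 => ν).real {ω | ∃ S : Finset (Fin n), L ≤ S.card ∧
      (S.card : ℝ) ≤ x0 * n ∧ Grow (graphOf n (φ ∘ ω)) R S ∧
      ∀ x ∈ S, ∀ y, y ∉ S → ¬ (graphOf n (ψ ∘ ω)).Adj x y} ≤
    (n + 1) * (D * Real.exp (-γ * L)) := by
  classical
  set μ := (Measure.pi fun _ : FaceIdx n 1 => ν)
  let Ev : ℕ → Set (FaceIdx n 1 → α) := fun s => {ω | ∃ S : Finset (Fin n), S.card = s ∧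
      Grow (graphOf n (φ ∘ ω)) R S ∧
      ∀ x ∈ S, ∀ y, y ∉ S → ¬ (graphOf n (ψ ∘ ω)).Adj x y}
  let I := (Finset.range (n + 1)).filter (fun s : ℕ => L ≤ s ∧ (s : ℝ) ≤ x0 * n)
  have hsub : {ω : FaceIdx n 1 → α | ∃ S : Finset (Fin n), L ≤ S.card ∧
      (S.card : ℝ) ≤ x0 * n ∧ Grow (graphOf n (φ ∘ ω)) R S ∧
      ∀ x ∈ S, ∀ y, y ∉ S → ¬ (graphOf n (ψ ∘ ω)).Adj x y} ⊆ ⋃ s ∈ I, Ev s := by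
    rintro ω ⟨S, h1, h2, h3⟩
    simp only [Set.mem_iUnion]
    refine ⟨S.card, ?_, S, rfl, h3⟩
    simp only [I, Finset.mem_filter, Finset.mem_range]
    refine ⟨?_, h1, h2⟩
    have := Finset.card_le_univ S
    rw [Fintype.card_fin] at this
    omega
  have hEv : ∀ s ∈ I, μ.real (Ev s) ≤ D * Real.exp (-γ * L) := by
    intro s hs
    simp only [I, Finset.mem_filter] at hs
    refine (first_moment ν φ ψ c c1 x0 hn hc.le hc1 ha hb R s hs.2.2).trans ?_
    calc _ ≤ D * c ^ s * Real.exp (s * (1 - c1 * (1 - x0))) := by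
          gcongr
          exact hD s
      _ = D * Real.exp (s * (Real.log c + 1 - c1 * (1 - x0))) := by
          have : c ^ s = Real.exp (s * Real.log c) := by
            rw [Real.exp_nat_mul, Real.exp_log hc]
          rw [this, mul_assoc, ← Real.exp_add]
          ring_nf
      _ ≤ _ := by
          refine mul_le_mul_of_nonneg_left (Real.exp_le_exp.2 ?_) hD0
          nlinarith [mul_le_mul_of_nonneg_left hg (Nat.cast_nonneg (α := ℝ) s),
            mul_le_mul_of_nonneg_left hs.2.1 hγ]
  calc μ.real _ ≤ _ := measureReal_mono hsub (measure_ne_top _ _)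
    _ ≤ ∑ s ∈ I, μ.real (Ev s) := measureReal_biUnion_finset_le _ _
    _ ≤ I.card • (D * Real.exp (-γ * L)) := Finset.sum_le_card_nsmul _ _ _ hEv
    _ ≤ _ := by
      rw [nsmul_eq_mul]
      gcongr
      have : I.card ≤ n + 1 := (Finset.card_filter_le _ _).trans (by simp)
      exact_mod_cast this

instance bern_prob (p : ℝ) : IsProbabilityMeasure (bernoulliBool p) := by
  constructor
  simp only [bernoulliBool, Measure.add_apply, Measure.smul_apply, smul_eq_mul,
    measure_univ, mul_one]
  rw [← ENNReal.ofReal_add (by positivity) (by simp)]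
  simp

lemma bern_true {p : ℝ} (h0 : 0 ≤ p) (h1 : p ≤ 1) : (bernoulliBool p).real {a | a = true} = p := by
  simp [measureReal_def, bernoulliBool, min_eq_left h1, max_eq_right h0, h0]

lemma bern_false {p : ℝ} (h0 : 0 ≤ p) (h1 : p ≤ 1) :
    (bernoulliBool p).real {a | a = false} = 1 - p := by
  simp [measureReal_def, bernoulliBool, min_eq_left h1, max_eq_right h0, h1]

instance ymeas_prob (n : ℕ) (p : ℝ) : IsProbabilityMeasure (YMeasure n 1 p) := by
  unfold YMeasure; infer_instance

lemma whp (c : ℝ) (good : ∀ n : ℕ, Set (FaceIdx n 1 → Bool)) (ε : ℕ → ℝ)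
    (hε : Tendsto ε atTop (nhds 0))
    (h : ∀ᶠ n : ℕ in atTop, (YMeasure n 1 (c / n)).real (good n)ᶜ ≤ ε n) :
    Tendsto (fun n : ℕ => YMeasure n 1 (c / n) (good n)) atTop (nhds 1) := by
  have h1 : Tendsto (fun n : ℕ => (YMeasure n 1 (c / n)).real (good n)ᶜ) atTop (nhds 0) :=
    tendsto_of_tendsto_of_tendsto_of_le_of_le' tendsto_const_nhds hε
      (Eventually.of_forall fun n => measureReal_nonneg) h
  have h2 : ∀ n : ℕ, YMeasure n 1 (c / n) (good n) =
      ENNReal.ofReal (1 - (YMeasure n 1 (c / n)).real (good n)ᶜ) := by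
    intro n
    have hm : MeasurableSet (good n) := (good n).toFinite.measurableSet
    rw [probReal_compl_eq_one_sub hm, sub_sub_cancel, ofReal_measureReal]
  simp_rw [h2]
  have h3 := ENNReal.tendsto_ofReal (tendsto_const_nhds (x := (1 : ℝ)).sub h1)
  simpa using h3

lemma rate_pos {c : ℝ} (hc : 0 < c) (h1 : c ≠ 1) : 0 < c - 1 - Real.log c := by
  have := Real.log_lt_sub_one_of_pos hc h1
  linarith

lemma subcritical (c : ℝ) (hc : 0 < c) (h1 : c < 1) : ∃ K : ℝ,
      Tendsto (fun n : ℕ => YMeasure n 1 (c / n)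
          {ω | ∀ C : (graphOf n ω).ConnectedComponent,
            (C.supp.ncard : ℝ) ≤ K * Real.log n})
        atTop (nhds (1 : ENNReal)) := by
  have hg := rate_pos hc h1.ne
  set g := c - 1 - Real.log c with hgdef
  set x0 := g / (2 * c) with hx0
  have hx0p : 0 < x0 := by positivity
  have hcx : c * x0 = g / 2 := by rw [hx0]; field_simp
  refine ⟨3 / (g / 2), ?_⟩
  refine whp c (fun n => {ω | ∀ C : (graphOf n ω).ConnectedComponent,
            (C.supp.ncard : ℝ) ≤ 3 / (g / 2) * Real.log n})
    (fun n => 2 / c * (n : ℝ)⁻¹ + 1 / ((1 - c) * x0 ^ 2) * (n : ℝ)⁻¹) ?_ ?_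
  · have h := tendsto_inv_atTop_zero.comp (tendsto_natCast_atTop_atTop (R := ℝ))
    have := (h.const_mul (2 / c)).add (h.const_mul (1 / ((1 - c) * x0 ^ 2)))
    simpa using this
  · filter_upwards [eventually_gt_atTop 0] with n hn
    have hn' : (0 : ℝ) < n := by exact_mod_cast hn
    have hn1 : (1 : ℝ) ≤ n := by exact_mod_cast hn
    have hp0 : 0 ≤ c / n := by positivity
    have hp1 : c / n ≤ 1 := by rw [div_le_one hn']; linarith
    unfold YMeasure
    set ν := bernoulliBool (c / n)
    set μ := (Measure.pi fun _ : FaceIdx n 1 => ν)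
    set L := 3 / (g / 2) * Real.log n with hL
    have ha : ν.real {a | id a = true} ≤ c / n := (bern_true hp0 hp1).le
    have hb : ν.real {a | id a = false} ≤ Real.exp (-c / n) := by
      have := bern_false hp0 hp1
      refine this.le.trans ?_
      have := Real.add_one_le_exp (-c / n)
      rw [neg_div] at *
      linarith
    let Ev : Fin n → Set (FaceIdx n 1 → Bool) := fun v => {ω | ∃ S : Finset (Fin n), L ≤ S.card ∧
      (S.card : ℝ) ≤ x0 * n ∧ Grow (graphOf n (id ∘ ω)) {v} S ∧
      ∀ x ∈ S, ∀ y, y ∉ S → ¬ (graphOf n (id ∘ ω)).Adj x y}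
    have hsub : {ω : FaceIdx n 1 → Bool | ∀ C : (graphOf n ω).ConnectedComponent,
            (C.supp.ncard : ℝ) ≤ L}ᶜ ⊆
        (⋃ v ∈ (Finset.univ : Finset (Fin n)), Ev v) ∪
          {ω | ∃ v, x0 * n ≤ (cf (graphOf n ω) v).card} := by
      intro ω hω
      simp only [Set.mem_compl_iff, Set.mem_ofPred_eq, not_forall, not_le] at hω
      obtain ⟨C, hC⟩ := hω
      induction C using SimpleGraph.ConnectedComponent.ind with | _ v => ?_
      rw [ncard_supp] at hC
      by_cases hbig : x0 * n ≤ (cf (graphOf n ω) v).card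
      · exact Or.inr ⟨v, hbig⟩
      · left
        simp only [Set.mem_iUnion]
        exact ⟨v, Finset.mem_univ _, cf (graphOf n ω) v, hC.le, (not_le.1 hbig).le,
          cf_grow _ v, cf_iso _ v⟩
    have hEv : ∀ v ∈ (Finset.univ : Finset (Fin n)), μ.real (Ev v) ≤
        (n + 1) * (1 / c * Real.exp (-(g / 2) * L)) := by
      intro v _
      refine tail_bound ν id id c c x0 (g / 2) L (1 / c) hn hc hc.le (by positivity) ?_ ha hb {v}
        (by positivity) ?_
      · have : c * (1 - x0) = c - g / 2 := by rw [mul_sub, hcx]; ring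
        rw [this]; linarith
      · intro s
        rcases s with _ | s
        · simp; exact (one_le_inv₀ hc).2 h1.le
        · simp [pow_succ]; field_simp; rfl
    have hexp : Real.exp (-(g / 2) * L) = ((n : ℝ) ^ 3)⁻¹ := by
      have : -(g / 2) * L = -((3 : ℕ) * Real.log n) := by
        rw [hL]; push_cast; field_simp
      rw [this, Real.exp_neg, Real.exp_nat_mul, Real.exp_log hn']
    calc μ.real _ ≤ _ := measureReal_mono hsub (measure_ne_top _ _)
      _ ≤ _ := measureReal_union_le _ _
      _ ≤ (n : ℝ) * ((n + 1) * (1 / c * Real.exp (-(g / 2) * L))) +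
          n / ((1 - c) * (x0 * n) ^ 2) := by
        refine add_le_add ?_ ?_
        · refine (measureReal_biUnion_finset_le _ _).trans
            ((Finset.sum_le_card_nsmul _ _ _ hEv).trans ?_)
          rw [nsmul_eq_mul]; simp
        · exact big_comp_bound hn ν c hc.le h1 ha _ (by positivity)
      _ ≤ _ := by
        rw [hexp]
        refine add_le_add ?_ ?_
        · have : (n : ℝ) * ((n + 1) * (1 / c * ((n : ℝ) ^ 3)⁻¹)) = (n + 1) / n * (1 / c * (n : ℝ)⁻¹) := by
            field_simp
          rw [this]
          have h2 : ((n : ℝ) + 1) / n ≤ 2 := by rw [div_le_iff₀ hn']; linarith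
          calc _ ≤ 2 * (1 / c * (n : ℝ)⁻¹) := by gcongr
            _ = _ := by ring
        · have : 1 - c ≠ 0 := by linarith
          apply le_of_eq
          field_simp

lemma exist_det {n : ℕ} (G : SimpleGraph (Fin n)) (m : ℝ) (hm : 0 < m)
    (hmn : m ≤ n)
    (h : ∀ t : ℕ, ¬ ∃ S : Finset (Fin n), m ≤ S.card ∧ (S.card : ℝ) ≤ 2 * m ∧
      Grow G (Finset.univ.filter (fun i : Fin n => i.val < t)) S ∧
      ∀ x ∈ S, ∀ y, y ∉ S → ¬ G.Adj x y) : ∃ v, m ≤ (cf G v).card := by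
  classical
  by_contra! hcon
  let U : ℕ → Finset (Fin n) := fun t => Finset.univ.filter
    (fun x => ∃ r : Fin n, r.val < t ∧ G.Reachable r x)
  have hU : ∀ t, ((U t).card : ℝ) < m := by
    intro t
    induction t with
    | zero => simpa [U] using hm
    | succ t ih =>
      have hle : ((U (t + 1)).card : ℝ) ≤ 2 * m := by
        by_cases ht : t < n
        · have hs : U (t + 1) ⊆ U t ∪ cf G ⟨t, ht⟩ := by
            intro x hx
            simp only [U, Finset.mem_filter, Finset.mem_univ, true_and, Finset.mem_union,
              mem_cf] at hx ⊢
            obtain ⟨r, hr, hrx⟩ := hx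
            rcases Nat.lt_succ_iff_lt_or_eq.1 hr with h1 | h1
            · exact Or.inl ⟨r, h1, hrx⟩
            · right
              have : r = ⟨t, ht⟩ := Fin.ext h1
              rwa [← this]
          have h1 := (Finset.card_le_card hs).trans (Finset.card_union_le _ _)
          have h2 : ((U (t + 1)).card : ℝ) ≤ (U t).card + (cf G ⟨t, ht⟩).card := by
            exact_mod_cast h1
          have := hcon ⟨t, ht⟩
          linarith
        · have hs : U (t + 1) ⊆ U t := by
            intro x hx
            simp only [U, Finset.mem_filter, Finset.mem_univ, true_and] at hx ⊢
            obtain ⟨r, hr, hrx⟩ := hx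
            exact ⟨r, by omega, hrx⟩
          have h2 : ((U (t + 1)).card : ℝ) ≤ (U t).card := by
            exact_mod_cast Finset.card_le_card hs
          linarith
      by_contra! hge
      refine h (t + 1) ⟨U (t + 1), hge, hle, ?_, ?_⟩
      · apply grow_of_reach
        · intro x hx
          simp only [U, Finset.mem_filter, Finset.mem_univ, true_and] at hx ⊢
          exact ⟨x, hx, SimpleGraph.Reachable.refl _⟩
        · intro x hx y hxy
          simp only [U, Finset.mem_filter, Finset.mem_univ, true_and] at hx ⊢
          obtain ⟨r, hr, hrx⟩ := hx
          exact ⟨r, hr, hrx.trans hxy.reachable⟩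
        · intro x hx
          simp only [U, Finset.mem_filter, Finset.mem_univ, true_and] at hx ⊢
          exact hx
      · intro x hx y hy hxy
        simp only [U, Finset.mem_filter, Finset.mem_univ, true_and] at hx hy
        obtain ⟨r, hr, hrx⟩ := hx
        exact hy ⟨r, hr, hrx.trans hxy.reachable⟩
  have h1 := hU n
  have h2 : U n = Finset.univ := by
    ext x
    simp only [U, Finset.mem_filter, Finset.mem_univ, true_and, iff_true]
    exact ⟨x, x.2, SimpleGraph.Reachable.refl _⟩
  rw [h2, Finset.card_univ, Fintype.card_fin] at h1
  linarith

lemma uniq_det {n : ℕ} (G G1 : SimpleGraph (Fin n)) (hle : G1 ≤ G) (m : ℝ) (v : Fin n)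
    (h : ¬ ∃ S : Finset (Fin n), m ≤ S.card ∧ (S.card : ℝ) ≤ 2 * m ∧
      Grow G {v} S ∧ ∀ x ∈ S, ∀ y, y ∉ S → ¬ G1.Adj x y) (hv : m ≤ (cf G v).card) :
    ∃ w ∈ cf G v, m ≤ (cf G1 w).card := by
  classical
  by_contra! hcon
  have hvv : v ∈ cf G v := mem_cf.2 (SimpleGraph.Reachable.refl _)
  have hsubc : ∀ x ∈ cf G v, cf G1 x ⊆ cf G v := by
    intro x hx z hz
    rw [mem_cf] at *
    exact hx.trans (hz.mono hle)
  obtain ⟨S, hS, hmax⟩ := Finset.exists_max_image ((cf G v).powerset.filter (fun S =>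
      (S.card : ℝ) ≤ 2 * m ∧ Grow G {v} S ∧ ∀ x ∈ S, ∀ y, y ∉ S → ¬ G1.Adj x y))
    Finset.card ⟨cf G1 v, by
      simp only [Finset.mem_filter, Finset.mem_powerset]
      refine ⟨hsubc v hvv, ?_, (cf_grow G1 v).mono hle, cf_iso G1 v⟩
      have h1 := hcon v hvv
      have : (0 : ℝ) ≤ (cf G1 v).card := by positivity
      linarith⟩
  simp only [Finset.mem_filter, Finset.mem_powerset] at hS hmax
  obtain ⟨hS1, hS2, hS3, hS4⟩ := hS
  by_cases hSm : m ≤ S.card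
  · exact h ⟨S, hSm, hS2, hS3, hS4⟩
  push Not at hSm
  have hne : S ≠ cf G v := by rintro rfl; linarith
  obtain ⟨z, hz, hzS⟩ := Finset.exists_of_ssubset (hS1.ssubset_of_ne hne)
  obtain ⟨p⟩ := mem_cf.1 hz
  obtain ⟨d, hd, h1, h2⟩ := p.exists_boundary_dart (S : Set (Fin n))
    (hS3.subset (by simp)) hzS
  simp only [Finset.mem_coe] at h1 h2
  set x := d.snd
  have hx : x ∈ cf G v := by
    have := hS1 h1
    rw [mem_cf] at this ⊢
    exact this.trans d.adj.reachable
  have hxc : x ∈ cf G1 x := mem_cf.2 (SimpleGraph.Reachable.refl _)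
  have h3 := hmax (cf G1 x ∪ S) ⟨Finset.union_subset (hsubc x hx) hS1, ?_, ?_, ?_⟩
  · have h4 : (insert x S).card ≤ (cf G1 x ∪ S).card := by
      apply Finset.card_le_card
      intro y hy
      rcases Finset.mem_insert.1 hy with rfl | hy
      · exact Finset.mem_union_left _ hxc
      · exact Finset.mem_union_right _ hy
    rw [Finset.card_insert_of_notMem h2] at h4
    omega
  · have h5 : ((cf G1 x ∪ S).card : ℝ) ≤ (cf G1 x).card + S.card := by
      exact_mod_cast Finset.card_union_le _ _
    have := hcon x hx
    linarith
  · have h6 : Grow G S ({x} ∪ S) :=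
      Relation.ReflTransGen.single ⟨x, d.fst, h1, h2, d.adj.symm, rfl⟩
    exact (hS3.trans h6).trans (((cf_grow G1 x).mono hle).union S)
  · intro a ha b hb hab
    simp only [Finset.mem_union, not_or] at ha hb
    rcases ha with ha | ha
    · exact cf_iso G1 x a ha b hb.1 hab
    · exact hS4 a ha b hb.2 hab

/-- Sprinkling measure on pairs of coins. -/
abbrev nu2 (p1 p2 : ℝ) : Measure (Bool × Bool) := (bernoulliBool p1).prod (bernoulliBool p2)

lemma nu2_fst_false {p1 p2 : ℝ} (h0 : 0 ≤ p1) (h1 : p1 ≤ 1) :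
    (nu2 p1 p2).real {a | a.1 = false} = 1 - p1 := by
  rw [← bern_false h0 h1]
  have : {a : Bool × Bool | a.1 = false} = {a | a = false} ×ˢ Set.univ := by
    ext a; simp
  rw [this, measureReal_prod_prod, probReal_univ, mul_one]

lemma nu2_or_false {p1 p2 : ℝ} (h0 : 0 ≤ p1) (h1 : p1 ≤ 1) (h2 : 0 ≤ p2) (h3 : p2 ≤ 1) :
    (nu2 p1 p2).real {a | (a.1 || a.2) = false} = (1 - p1) * (1 - p2) := by
  rw [← bern_false h0 h1, ← bern_false h2 h3]
  have : {a : Bool × Bool | (a.1 || a.2) = false} = {a | a = false} ×ˢ {a | a = false} := by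
    ext ⟨a, b⟩; cases a <;> cases b <;> simp
  rw [this, measureReal_prod_prod]

lemma nu2_map {p p1 p2 : ℝ} (h0 : 0 ≤ p1) (h1 : p1 ≤ 1) (h2 : 0 ≤ p2) (h3 : p2 ≤ 1)
    (h4 : 0 ≤ p) (h5 : p ≤ 1) (he : 1 - p = (1 - p1) * (1 - p2)) :
    (nu2 p1 p2).map (fun a => a.1 || a.2) = bernoulliBool p := by
  have hm : Measurable (fun a : Bool × Bool => a.1 || a.2) := measurable_of_finite _
  have : IsProbabilityMeasure ((nu2 p1 p2).map (fun a => a.1 || a.2)) :=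
    Measure.isProbabilityMeasure_map hm.aemeasurable
  have hf : ((nu2 p1 p2).map (fun a => a.1 || a.2)).real {false} =
      (bernoulliBool p).real {false} := by
    have e1 : (bernoulliBool p).real {false} = 1 - p := bern_false h4 h5
    rw [e1, he, ← nu2_or_false h0 h1 h2 h3, map_measureReal_apply hm (by simp)]
    rfl
  have ht : ({true} : Set Bool) = {false}ᶜ := by ext a; cases a <;> simp
  apply Measure.ext_of_singleton
  intro a
  rw [← measureReal_eq_measureReal_iff]
  cases a
  · exact hf
  · rw [ht, probReal_compl_eq_one_sub (by simp), probReal_compl_eq_one_sub (by simp), hf]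

lemma YMeasure_eq {n : ℕ} {p p1 p2 : ℝ} (h0 : 0 ≤ p1) (h1 : p1 ≤ 1) (h2 : 0 ≤ p2) (h3 : p2 ≤ 1)
    (h4 : 0 ≤ p) (h5 : p ≤ 1) (he : 1 - p = (1 - p1) * (1 - p2)) (s : Set (FaceIdx n 1 → Bool)) :
    (YMeasure n 1 p).real s = (Measure.pi fun _ : FaceIdx n 1 => nu2 p1 p2).real
      {ω | ((fun a : Bool × Bool => a.1 || a.2) ∘ ω) ∈ s} := by
  have hm : Measurable (fun a : Bool × Bool => a.1 || a.2) := measurable_of_finite _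
  have e := nu2_map h0 h1 h2 h3 h4 h5 he
  have : IsProbabilityMeasure ((nu2 p1 p2).map (fun a => a.1 || a.2)) :=
    Measure.isProbabilityMeasure_map hm.aemeasurable
  have h := Measure.pi_map_pi (ι := FaceIdx n 1) (μ := fun _ => nu2 p1 p2)
    (f := fun _ a => a.1 || a.2) (fun _ => hm.aemeasurable)
  unfold YMeasure
  rw [← e, ← h, map_measureReal_apply (measurable_of_finite _) s.toFinite.measurableSet]
  rfl

lemma sprinkle {n : ℕ} {p1 p2 m β : ℝ} (h2 : 0 ≤ p2) (h3 : p2 ≤ 1) (hm : 0 ≤ m)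
    (hβ : ∀ k : ℕ, m * m ≤ k → (1 - p2) ^ k ≤ β) (hβ0 : 0 ≤ β) :
    (Measure.pi fun _ : FaceIdx n 1 => nu2 p1 p2).real
      {ω | ∃ v w : Fin n, m ≤ (cf (graphOf n (Prod.fst ∘ ω)) v).card ∧
        m ≤ (cf (graphOf n (Prod.fst ∘ ω)) w).card ∧
        Disjoint (cf (graphOf n (Prod.fst ∘ ω)) v) (cf (graphOf n (Prod.fst ∘ ω)) w) ∧
        ∀ x ∈ cf (graphOf n (Prod.fst ∘ ω)) v, ∀ y ∈ cf (graphOf n (Prod.fst ∘ ω)) w,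
          ¬ (graphOf n (Prod.snd ∘ ω)).Adj x y} ≤ n * n * β := by
  classical
  have hmp := measurePreserving_arrowProdEquivProdArrow Bool Bool (FaceIdx n 1)
    (fun _ => bernoulliBool p1) (fun _ => bernoulliBool p2)
  set P1 := (Measure.pi fun _ : FaceIdx n 1 => bernoulliBool p1)
  set P2 := (Measure.pi fun _ : FaceIdx n 1 => bernoulliBool p2)
  let Bad : Fin n → Fin n → Set ((FaceIdx n 1 → Bool) × (FaceIdx n 1 → Bool)) := fun v w =>
    {q | m ≤ (cf (graphOf n q.1) v).card ∧ m ≤ (cf (graphOf n q.1) w).card ∧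
        Disjoint (cf (graphOf n q.1) v) (cf (graphOf n q.1) w) ∧
        ∀ x ∈ cf (graphOf n q.1) v, ∀ y ∈ cf (graphOf n q.1) w, ¬ (graphOf n q.2).Adj x y}
  have hslice : ∀ v w a, P2 {b | (a, b) ∈ Bad v w} ≤ ENNReal.ofReal β := by
    intro v w a
    set X := cf (graphOf n a) v with hX
    set Y := cf (graphOf n a) w with hY
    by_cases hc : m ≤ X.card ∧ m ≤ Y.card ∧ Disjoint X Y
    · obtain ⟨c1, c2, c3⟩ := hc
      have hne : ∀ k : ↥X × ↥Y, (k.1 : Fin n) ≠ (k.2 : Fin n) := fun k e =>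
        Finset.disjoint_left.1 c3 k.1.2 (e ▸ k.2.2)
      have := cyl_graph (n := n) (bernoulliBool p2) id id Empty.elim Empty.elim
        (fun k : ↥X × ↥Y => (k.1 : Fin n)) (fun k => (k.2 : Fin n)) (fun k => k.elim) hne
        (fun k => k.elim)
        (by
          rintro ⟨a, b⟩ ⟨a', b'⟩ e
          simp only at e
          have e1 : (a : Fin n) ∈ ({(a' : Fin n), (b' : Fin n)} : Finset (Fin n)) := by
            rw [← e]; simp
          have e2 : (b : Fin n) ∈ ({(a' : Fin n), (b' : Fin n)} : Finset (Fin n)) := by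
            rw [← e]; simp
          simp only [Finset.mem_insert, Finset.mem_singleton] at e1 e2
          have f1 : (a : Fin n) = a' := by
            rcases e1 with h | h
            · exact h
            · exact absurd (h ▸ b'.2) (Finset.disjoint_left.1 c3 a.2)
          have f2 : (b : Fin n) = b' := by
            rcases e2 with h | h
            · exact absurd b.2 (Finset.disjoint_left.1 c3 (h ▸ a'.2))
            · exact h
          exact Prod.ext (Subtype.ext f1) (Subtype.ext f2))
        (fun k => k.elim)
      simp only [Fintype.card_empty, pow_zero, one_mul, Fintype.card_prod, Fintype.card_coe] at this
      have hbf : (bernoulliBool p2).real {a | id a = false} = 1 - p2 := bern_false h2 h3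
      rw [hbf] at this
      have hle : P2.real {b | (a, b) ∈ Bad v w} ≤ β := by
        refine (measureReal_mono ?_ (measure_ne_top _ _)).trans (this.le.trans (hβ _ ?_))
        · rintro b ⟨_, _, _, hb⟩
          exact ⟨fun k => k.elim, fun k => hb _ k.1.2 _ k.2.2⟩
        · push_cast
          exact mul_le_mul c1 c2 hm (by positivity)
      rw [← ofReal_measureReal (μ := P2)]
      exact ENNReal.ofReal_le_ofReal hle
    · have : {b | (a, b) ∈ Bad v w} = ∅ := by
        ext b
        simp only [Set.mem_ofPred_eq, Set.mem_empty_iff_false, iff_false]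
        exact fun hb => hc ⟨hb.1, hb.2.1, hb.2.2.1⟩
      rw [this]; simp
  have hBad : ∀ v w, (P1.prod P2).real (Bad v w) ≤ β := by
    intro v w
    apply ENNReal.toReal_le_of_le_ofReal hβ0
    rw [Measure.prod_apply (Bad v w).toFinite.measurableSet]
    calc _ ≤ ∫⁻ _, ENNReal.ofReal β ∂P1 := lintegral_mono (fun a => hslice v w a)
      _ = _ := by simp
  let BB := ⋃ q ∈ (Finset.univ : Finset (Fin n × Fin n)), Bad q.1 q.2
  have hBB : (P1.prod P2).real BB ≤ n * n * β := by
    refine (measureReal_biUnion_finset_le _ _).trans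
      ((Finset.sum_le_card_nsmul _ _ _ (fun q _ => hBad q.1 q.2)).trans ?_)
    rw [nsmul_eq_mul]; simp
  have hpre := hmp.measureReal_preimage (s := BB) BB.toFinite.measurableSet.nullMeasurableSet
  rw [← hpre] at hBB
  refine (measureReal_mono ?_ (measure_ne_top _ _)).trans hBB
  rintro ω ⟨v, w, h⟩
  simp only [BB, Set.mem_preimage, Set.mem_iUnion]
  exact ⟨(v, w), Finset.mem_univ _, h⟩

lemma sq_exp_tendsto {b : ℝ} (hb : 0 < b) :
    Tendsto (fun n : ℕ => (n : ℝ) ^ 2 * Real.exp (-b * n)) atTop (nhds 0) := by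
  have h := (tendsto_rpow_mul_exp_neg_mul_atTop_nhds_zero 2 b hb).comp
    (tendsto_natCast_atTop_atTop (R := ℝ))
  refine h.congr fun n => ?_
  simp

lemma graph_mono {n : ℕ} {ω ω' : FaceIdx n 1 → Bool} (h : ∀ e, ω e = true → ω' e = true) :
    graphOf n ω ≤ graphOf n ω' := by
  rintro i j ⟨hne, e, he, hi, hj⟩
  exact ⟨hne, e, h e he, hi, hj⟩

set_option maxHeartbeats 1600000 in
lemma supercritical (c : ℝ) (h1 : 1 < c) : ∃ δ : ℝ, 0 < δ ∧
      Tendsto (fun n : ℕ => YMeasure n 1 (c / n)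
          {ω | ∃! C : (graphOf n ω).ConnectedComponent,
            δ * n ≤ (C.supp.ncard : ℝ)})
        atTop (nhds (1 : ENNReal)) := by
  have hc : 0 < c := by linarith
  have hg := rate_pos hc h1.ne'
  set g := c - 1 - Real.log c with hgdef
  have hlog : 0 < Real.log c := Real.log_pos h1
  set c1 := c - g / 3 with hc1def
  have hc1 : 0 < c1 := by linarith
  have hc1c : c1 < c := by linarith
  set x0 := g / (3 * c1) with hx0
  have hx0p : 0 < x0 := by positivity
  have hcx : c1 * x0 = g / 3 := by rw [hx0]; field_simp
  have hx01 : x0 ≤ 1 := by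
    rw [hx0, div_le_one (by positivity)]; linarith
  set δ := x0 / 2 with hδ
  have hδp : 0 < δ := by positivity
  refine ⟨δ, hδp, ?_⟩
  refine whp c (fun n => {ω | ∃! C : (graphOf n ω).ConnectedComponent,
            δ * n ≤ (C.supp.ncard : ℝ)})
    (fun n => 4 * ((n : ℝ) ^ 2 * Real.exp (-(g / 3 * δ) * n)) +
      2 * ((n : ℝ) ^ 2 * Real.exp (-(g / 3 * δ) * n)) +
      (n : ℝ) ^ 2 * Real.exp (-(g / 3 * δ ^ 2) * n)) ?_ ?_
  · have ha := sq_exp_tendsto (show 0 < g / 3 * δ by positivity)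
    have hb := sq_exp_tendsto (show 0 < g / 3 * δ ^ 2 by positivity)
    simpa using ((ha.const_mul 4).add (ha.const_mul 2)).add hb
  · filter_upwards [eventually_gt_atTop 0, eventually_gt_atTop ⌈c⌉₊] with n hn hnc
    have hn' : (0 : ℝ) < n := by exact_mod_cast hn
    have hn1 : (1 : ℝ) ≤ n := by exact_mod_cast hn
    have hcn : c < n := (Nat.le_ceil c).trans_lt (by exact_mod_cast hnc)
    set p := c / n with hp
    set p1 := c1 / n with hp1
    have hp0 : 0 ≤ p := by positivity
    have hplt : p < 1 := by rw [hp, div_lt_one hn']; exact hcn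
    have hp10 : 0 ≤ p1 := by positivity
    have hpp : p - p1 = g / 3 / n := by rw [hp, hp1, ← sub_div, hc1def]; ring
    have hpp' : 0 < p - p1 := by rw [hpp]; positivity
    have hp1lt : p1 < 1 := by linarith
    set p2 := (p - p1) / (1 - p1) with hp2
    have hd : 0 < 1 - p1 := by linarith
    have hp20 : 0 ≤ p2 := by positivity
    have hp21 : p2 ≤ 1 := by rw [hp2, div_le_one hd]; linarith
    have hp2ge : g / 3 / n ≤ p2 := by
      rw [← hpp, hp2, le_div_iff₀ hd]; nlinarith
    have he : 1 - p = (1 - p1) * (1 - p2) := by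
      rw [hp2]; field_simp; ring
    rw [YMeasure_eq hp10 hp1lt.le hp20 hp21 hp0 hplt.le he]
    set ν := nu2 p1 p2
    set μ := (Measure.pi fun _ : FaceIdx n 1 => ν)
    set φ : Bool × Bool → Bool := fun a => a.1 || a.2 with hφ
    have ha : ν.real {a | φ a = true} ≤ c / n := by
      have h : {a : Bool × Bool | φ a = true} = {a | φ a = false}ᶜ := by ext a; simp
      rw [h, probReal_compl_eq_one_sub (Set.toFinite _).measurableSet,
        nu2_or_false hp10 hp1lt.le hp20 hp21, ← he]
      linarith
    have hb : ν.real {a | Prod.fst a = false} ≤ Real.exp (-c1 / n) := by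
      rw [nu2_fst_false hp10 hp1lt.le]
      have := Real.add_one_le_exp (-c1 / n)
      rw [neg_div] at *
      linarith
    set m := δ * n with hm
    have hm0 : 0 < m := by positivity
    have hm2 : 2 * m = x0 * n := by rw [hm, hδ]; ring
    have hmn : m ≤ n := by rw [hm, hδ]; nlinarith
    let Ev : Finset (Fin n) → Set (FaceIdx n 1 → Bool × Bool) := fun R =>
      {ω | ∃ S : Finset (Fin n), m ≤ S.card ∧
      (S.card : ℝ) ≤ x0 * n ∧ Grow (graphOf n (φ ∘ ω)) R S ∧
      ∀ x ∈ S, ∀ y, y ∉ S → ¬ (graphOf n (Prod.fst ∘ ω)).Adj x y}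
    let Rt : ℕ → Finset (Fin n) := fun t => Finset.univ.filter (fun i : Fin n => i.val < t)
    let Sp : Set (FaceIdx n 1 → Bool × Bool) :=
      {ω | ∃ v w : Fin n, m ≤ (cf (graphOf n (Prod.fst ∘ ω)) v).card ∧
        m ≤ (cf (graphOf n (Prod.fst ∘ ω)) w).card ∧
        Disjoint (cf (graphOf n (Prod.fst ∘ ω)) v) (cf (graphOf n (Prod.fst ∘ ω)) w) ∧
        ∀ x ∈ cf (graphOf n (Prod.fst ∘ ω)) v, ∀ y ∈ cf (graphOf n (Prod.fst ∘ ω)) w,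
          ¬ (graphOf n (Prod.snd ∘ ω)).Adj x y}
    have hEv : ∀ R, μ.real (Ev R) ≤ (n + 1) * (1 * Real.exp (-(g / 3) * m)) := by
      intro R
      refine tail_bound ν φ Prod.fst c c1 x0 (g / 3) m 1 hn hc hc1.le (by positivity) ?_ ha hb R
        zero_le_one ?_
      · have : c1 * (1 - x0) = c1 - g / 3 := by rw [mul_sub, hcx]; ring
        rw [this]; linarith
      · intro s
        rw [one_mul]
        exact pow_le_pow_right₀ h1.le (Nat.sub_le _ _)
    have hSp : μ.real Sp ≤ n * n * Real.exp (-(g / 3 * δ ^ 2) * n) := by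
      refine sprinkle hp20 hp21 hm0.le ?_ (Real.exp_pos _).le
      intro k hk
      calc (1 - p2) ^ k ≤ Real.exp (-p2) ^ k := by
            have := Real.add_one_le_exp (-p2)
            exact pow_le_pow_left₀ (by linarith) (by linarith) k
        _ = Real.exp (k * -p2) := by rw [Real.exp_nat_mul]
        _ ≤ _ := by
            apply Real.exp_le_exp.2
            have h := mul_le_mul hk hp2ge (by positivity) (by positivity)
            have : m * m * (g / 3 / n) = g / 3 * δ ^ 2 * n := by rw [hm]; field_simp
            rw [this] at h
            linarith
    have hsub : {ω : FaceIdx n 1 → Bool × Bool | (φ ∘ ω) ∈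
        {ω | ∃! C : (graphOf n ω).ConnectedComponent, m ≤ (C.supp.ncard : ℝ)}ᶜ} ⊆
        ((⋃ t ∈ Finset.range (n + 1), Ev (Rt t)) ∪
          (⋃ v ∈ (Finset.univ : Finset (Fin n)), Ev {v})) ∪ Sp := by
      intro ω hω
      by_contra hcon
      simp only [Set.mem_union, not_or, Set.mem_iUnion, not_exists] at hcon
      obtain ⟨⟨hA, hB⟩, hC⟩ := hcon
      apply hω
      set G := graphOf n (φ ∘ ω) with hG
      set G1 := graphOf n (Prod.fst ∘ ω) with hG1
      have hle1 : G1 ≤ G := graph_mono fun e he => by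
        simp only [Function.comp] at he; simp [hφ, he]
      have hle2 : graphOf n (Prod.snd ∘ ω) ≤ G := graph_mono fun e he => by
        simp only [Function.comp] at he; simp [hφ, he]
      obtain ⟨v, hv⟩ := exist_det G m hm0 hmn (by
        rintro t ⟨S, hS1, hS2, hS3, hS4⟩
        have hR : (Finset.univ.filter (fun i : Fin n => i.val < t)) = Rt (min t n) := by
          ext i; simp [Rt]
        rw [hR] at hS3
        exact hA (min t n) (by simp) ⟨S, hS1, hm2 ▸ hS2, hS3,
          fun x hx y hy hxy => hS4 x hx y hy (hle1 hxy)⟩)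
      have hU : ∀ v, m ≤ (cf G v).card → ∃ w ∈ cf G v, m ≤ (cf G1 w).card := by
        intro v hv
        refine uniq_det G G1 hle1 m v ?_ hv
        rintro ⟨S, hS1, hS2, hS3⟩
        exact hB v (Finset.mem_univ _) ⟨S, hS1, hm2 ▸ hS2, hS3⟩
      refine ⟨G.connectedComponentMk v, ?_, ?_⟩
      · show m ≤ ((G.connectedComponentMk v).supp.ncard : ℝ)
        rw [ncard_supp]; exact hv
      · intro C hCm
        induction C using SimpleGraph.ConnectedComponent.ind with | _ u => ?_
        replace hCm : m ≤ ((G.connectedComponentMk u).supp.ncard : ℝ) := hCm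
        rw [ncard_supp] at hCm
        rw [SimpleGraph.ConnectedComponent.eq]
        by_contra hnr
        obtain ⟨a, ha1, ha2⟩ := hU u hCm
        obtain ⟨b, hb1, hb2⟩ := hU v hv
        rw [mem_cf] at ha1 hb1
        refine hC ⟨a, b, ha2, hb2, ?_, ?_⟩
        · rw [Finset.disjoint_left]
          intro x hx hx'
          rw [mem_cf] at hx hx'
          exact hnr (ha1.trans ((hx.mono hle1).trans ((hx'.mono hle1).symm.trans hb1.symm)))
        · intro x hx y hy hxy
          rw [mem_cf] at hx hy
          exact hnr (ha1.trans ((hx.mono hle1).trans ((hle2 hxy).reachable.trans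
            ((hy.mono hle1).symm.trans hb1.symm))))
    have hexp : Real.exp (-(g / 3) * m) = Real.exp (-(g / 3 * δ) * n) := by
      rw [hm]; ring_nf
    have hE1 : μ.real (⋃ t ∈ Finset.range (n + 1), Ev (Rt t)) ≤
        (n + 1 : ℝ) * ((n + 1) * (1 * Real.exp (-(g / 3) * m))) := by
      refine (measureReal_biUnion_finset_le _ _).trans
        ((Finset.sum_le_card_nsmul _ _ _ (fun t _ => hEv (Rt t))).trans (le_of_eq ?_))
      rw [nsmul_eq_mul, Finset.card_range]; push_cast; rfl
    have hE2 : μ.real (⋃ v ∈ (Finset.univ : Finset (Fin n)), Ev {v}) ≤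
        (n : ℝ) * ((n + 1) * (1 * Real.exp (-(g / 3) * m))) := by
      refine (measureReal_biUnion_finset_le _ _).trans
        ((Finset.sum_le_card_nsmul _ _ _ (fun v _ => hEv {v})).trans (le_of_eq ?_))
      rw [nsmul_eq_mul, Finset.card_univ, Fintype.card_fin]
    clear_value Ev Rt Sp
    have hfin := (measureReal_mono hsub (measure_ne_top μ _)).trans
      ((measureReal_union_le _ _).trans
        (add_le_add ((measureReal_union_le _ _).trans (add_le_add hE1 hE2)) hSp))
    refine hfin.trans ?_
    rw [hexp, one_mul]
    set X := Real.exp (-(g / 3 * δ) * n)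
    have hX : 0 ≤ X := (Real.exp_pos _).le
    have q1 : ((n : ℝ) + 1) * (n + 1) ≤ 4 * (n : ℝ) ^ 2 := by nlinarith
    have q2 : (n : ℝ) * (n + 1) ≤ 2 * (n : ℝ) ^ 2 := by nlinarith
    have r1 := mul_le_mul_of_nonneg_right q1 hX
    have r2 := mul_le_mul_of_nonneg_right q2 hX
    nlinarith

end

noncomputable section
/-- **The phase transition for the giant component.**
Let `p = c/n`. If `c < 1` then w.h.p. every connected component of `G(n,p)` has
`O(log n)` vertices; if `c > 1` then there is `δ > 0` such that w.h.p. `G(n,p)`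
has a unique connected component on at least `δ·n` vertices. -/
theorem giant_component_phase_transition (c : ℝ) (hc : 0 < c) :
    (c < 1 → ∃ K : ℝ,
      Tendsto (fun n : ℕ => YMeasure n 1 (c / n)
          {ω | ∀ C : (graphOf n ω).ConnectedComponent,
            (C.supp.ncard : ℝ) ≤ K * Real.log n})
        atTop (nhds (1 : ENNReal))) ∧
    (1 < c → ∃ δ : ℝ, 0 < δ ∧
      Tendsto (fun n : ℕ => YMeasure n 1 (c / n)
          {ω | ∃! C : (graphOf n ω).ConnectedComponent,
            δ * n ≤ (C.supp.ncard : ℝ)})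
        atTop (nhds (1 : ENNReal))) := by
  exact ⟨fun h => subcritical c hc h, fun h => supercritical c h⟩
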